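/- Fix z_R > 0, λ_a > 0, a nonzero mode l_m ∈ ℤ, a wavelength λ_i > 0, a nonzero mode l ∈ ℤ and z > 0, and let β* = √(λ_i·|l| / (λ_a·|l_m|)). Then the map Δβ ↦ g(λ_i, l, (β* + Δβ)·r_max(λ_a, l_m, z), z) / g(λ_i, l, (β* − Δβ)·r_max(λ_a, l_m, z), z) is strictly increasing on (0, β*), and its value exceeds 1 for every 0 < Δβ < β*; that is, the link gain decays strictly faster on the inner side (β < β*) of the maximum-gain radius than on the outer side (β > β*). -/

import Mathlib

open scoped BigOperators

/-- Squared beam waist: `ω(λ)² = λ·z_R/π`. -/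
noncomputable def waistSq (zR lam : ℝ) : ℝ := lam * zR / Real.pi

/-- Squared beam spot at axial distance `z`: `ω(λ,z)² = ω(λ)²·(1 + z²/z_R²)`. -/
noncomputable def spotSq (zR lam z : ℝ) : ℝ := waistSq zR lam * (1 + z ^ 2 / zR ^ 2)

/-- Maximum-strength radius `r_max(λ,l,z) = √(|l|/2)·ω(λ,z)`. -/
noncomputable def rmax (zR lam : ℝ) (l : ℤ) (z : ℝ) : ℝ :=
  Real.sqrt ((l.natAbs : ℝ) / 2 * spotSq zR lam z)

/-- `d_m(λ,l,z) = √(r_max(λ,l,z)² + z²)`; in particular `d_m(λ,0,z) = z` for `z > 0`. -/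
noncomputable def dm (zR lam : ℝ) (l : ℤ) (z : ℝ) : ℝ :=
  Real.sqrt (rmax zR lam l z ^ 2 + z ^ 2)

/-- OAM link gain at radius `r` and axial distance `z` (Equation (2) of the paper). -/
noncomputable def gain (zR lam : ℝ) (l : ℤ) (r z : ℝ) : ℝ :=
  if l = 0 then
    lam ^ 2 / ((4 * Real.pi) ^ 2 * z ^ 2) * Real.exp (-2 * r ^ 2 / spotSq zR lam z)
  else
    lam ^ 2 / ((4 * Real.pi) ^ 2 * dm zR lam l z ^ 2) *
      (r / rmax zR lam l z) ^ (2 * l.natAbs) *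
      Real.exp (2 * (rmax zR lam l z ^ 2 - r ^ 2) / spotSq zR lam z)

lemma aux_strictMono :
    StrictMonoOn (fun x : ℝ => (1 + x) / (1 - x) * Real.exp (-2 * x)) (Set.Ico 0 1) := by
  have hd : ∀ x : ℝ, x < 1 → HasDerivAt (fun x : ℝ => (1 + x) / (1 - x) * Real.exp (-2 * x))
      ((1 * (1 - x) - (1 + x) * (-1)) / (1 - x) ^ 2 * Real.exp (-2 * x)
        + (1 + x) / (1 - x) * (Real.exp (-2 * x) * (-2 * 1))) x := by
    intro x hx
    have h0 : (1 - x) ≠ 0 := by linarith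
    exact (((hasDerivAt_id x).const_add 1).div ((hasDerivAt_id x).const_sub 1) h0).mul
      (((hasDerivAt_id x).const_mul (-2)).exp)
  apply strictMonoOn_of_deriv_pos (convex_Ico 0 1)
  · intro x hx
    exact (hd x hx.2).continuousAt.continuousWithinAt
  · intro x hx
    rw [interior_Ico] at hx
    rw [(hd x hx.2).deriv]
    have h0 : 0 < 1 - x := by linarith [hx.2]
    have : (1 * (1 - x) - (1 + x) * (-1)) / (1 - x) ^ 2 * Real.exp (-2 * x)
        + (1 + x) / (1 - x) * (Real.exp (-2 * x) * (-2 * 1))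
        = 2 * x ^ 2 / (1 - x) ^ 2 * Real.exp (-2 * x) := by
      field_simp
      ring
    rw [this]
    have := hx.1
    positivity

lemma aux_spot_pos (zR lam z : ℝ) (hzR : 0 < zR) (hlam : 0 < lam) : 0 < spotSq zR lam z := by
  unfold spotSq waistSq
  have := Real.pi_pos
  positivity

lemma aux_ratio (zR lam : ℝ) (l : ℤ) (hl : l ≠ 0) (z : ℝ) (hzR : 0 < zR) (hlam : 0 < lam)
    (hz : 0 < z) (b rA d : ℝ) (hb : 0 < b) (hbr : b * rA = rmax zR lam l z) (hdb : d < b) :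
    gain zR lam l ((b + d) * rA) z / gain zR lam l ((b - d) * rA) z
      = ((1 + d / b) / (1 - d / b) * Real.exp (-2 * (d / b))) ^ (2 * l.natAbs) := by
  have hS := aux_spot_pos zR lam z hzR hlam
  have hn : (0 : ℝ) < l.natAbs := by exact_mod_cast Int.natAbs_pos.mpr hl
  have hR2 : rmax zR lam l z ^ 2 = (l.natAbs : ℝ) / 2 * spotSq zR lam z := by
    unfold rmax
    exact Real.sq_sqrt (by positivity)
  have hR : 0 < rmax zR lam l z := by
    unfold rmax
    exact Real.sqrt_pos.mpr (by positivity)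
  have hdm : 0 < dm zR lam l z := by
    unfold dm
    exact Real.sqrt_pos.mpr (by positivity)
  have hg : ∀ t : ℝ, gain zR lam l ((b + t) * rA) z
      = lam ^ 2 / ((4 * Real.pi) ^ 2 * dm zR lam l z ^ 2) * (1 + t / b) ^ (2 * l.natAbs) *
        Real.exp (l.natAbs * (1 - (1 + t / b) ^ 2)) := by
    intro t
    have h1 : (b + t) * rA = (1 + t / b) * rmax zR lam l z := by
      rw [← hbr]; field_simp
    unfold gain
    rw [if_neg hl, h1, mul_div_assoc, div_self hR.ne', mul_one, mul_pow (1 + t / b), hR2]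
    congr 2
    field_simp
  have hx : 0 < 1 - d / b := by
    have := (div_lt_one hb).mpr hdb
    linarith
  have h2 := hg (-d)
  rw [← sub_eq_add_neg, neg_div, ← sub_eq_add_neg] at h2
  rw [hg d, h2, mul_pow ((1 + d / b) / (1 - d / b)), div_pow, ← Real.exp_nat_mul]
  have hC : 0 < lam ^ 2 / ((4 * Real.pi) ^ 2 * dm zR lam l z ^ 2) := by
    have := Real.pi_pos
    positivity
  have he : Real.exp (l.natAbs * (1 - (1 + d / b) ^ 2))
      = Real.exp (((2 * l.natAbs : ℕ) : ℝ) * (-2 * (d / b))) *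
        Real.exp (l.natAbs * (1 - (1 - d / b) ^ 2)) := by
    rw [← Real.exp_add]
    congr 1
    push_cast
    ring
  rw [he]
  generalize lam ^ 2 / ((4 * Real.pi) ^ 2 * dm zR lam l z ^ 2) = C at *
  have hp : (1 - d / b) ^ (2 * l.natAbs) ≠ 0 := (pow_pos hx _).ne'
  generalize (1 - d / b) ^ (2 * l.natAbs) = P at *
  have hE := Real.exp_ne_zero (l.natAbs * (1 - (1 - d / b) ^ 2))
  generalize Real.exp (l.natAbs * (1 - (1 - d / b) ^ 2)) = E at *
  generalize Real.exp (((2 * l.natAbs : ℕ) : ℝ) * (-2 * (d / b))) = F at *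
  generalize (1 + d / b) ^ (2 * l.natAbs) = Q at *
  have := hC.ne'
  field_simp

/-- The boundary-region gain ratio `a_r(Δβ)` is strictly increasing on `(0, β*)` and exceeds `1`
there: the link gain decays strictly faster on the inner side of the maximum-gain radius
`β* = √(λ_i|l|/(λ_a|l_m|))` than on the outer side. -/
theorem boundary_gain_ratio_strictMono_and_gt_one
    (zR lamA : ℝ) (lm : ℤ) (hzR : 0 < zR) (hlamA : 0 < lamA) (hlm : lm ≠ 0)
    (lamI : ℝ) (hlamI : 0 < lamI) (l : ℤ) (hl : l ≠ 0) (z : ℝ) (hz : 0 < z)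
    (βstar : ℝ) (hβstar : βstar = Real.sqrt (lamI * (l.natAbs : ℝ) / (lamA * (lm.natAbs : ℝ)))) :
    StrictMonoOn
      (fun Δβ => gain zR lamI l ((βstar + Δβ) * rmax zR lamA lm z) z /
                 gain zR lamI l ((βstar - Δβ) * rmax zR lamA lm z) z)
      (Set.Ioo 0 βstar) ∧
    (∀ Δβ : ℝ, 0 < Δβ → Δβ < βstar →
      1 < gain zR lamI l ((βstar + Δβ) * rmax zR lamA lm z) z /
            gain zR lamI l ((βstar - Δβ) * rmax zR lamA lm z) z) := by
  have hn : (0 : ℝ) < l.natAbs := by exact_mod_cast Int.natAbs_pos.mpr hl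
  have hm : (0 : ℝ) < lm.natAbs := by exact_mod_cast Int.natAbs_pos.mpr hlm
  have hb : 0 < βstar := by
    rw [hβstar]
    exact Real.sqrt_pos.mpr (by positivity)
  have hbr : βstar * rmax zR lamA lm z = rmax zR lamI l z := by
    rw [hβstar]
    unfold rmax
    rw [← Real.sqrt_mul (by positivity)]
    congr 1
    unfold spotSq waistSq
    field_simp
  have hk : 2 * l.natAbs ≠ 0 := by
    have := Int.natAbs_pos.mpr hl
    omega
  have hr := fun d (hd : d < βstar) =>
    aux_ratio zR lamI l hl z hzR hlamI hz βstar (rmax zR lamA lm z) d hb hbr hd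
  have key : ∀ x y : ℝ, 0 ≤ x → x < y → y < βstar →
      ((1 + x / βstar) / (1 - x / βstar) * Real.exp (-2 * (x / βstar))) ^ (2 * l.natAbs)
      < ((1 + y / βstar) / (1 - y / βstar) * Real.exp (-2 * (y / βstar))) ^ (2 * l.natAbs) := by
    intro x y hx hxy hy
    have hx1 : x / βstar < 1 := (div_lt_one hb).mpr (hxy.trans hy)
    have hy1 : y / βstar < 1 := (div_lt_one hb).mpr hy
    have hx0 : 0 ≤ x / βstar := by positivity
    have hlt : x / βstar < y / βstar := by gcongr
    have h := aux_strictMono ⟨hx0, hx1⟩ ⟨hx0.trans hlt.le, hy1⟩ hlt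
    refine pow_lt_pow_left₀ h ?_ hk
    have : 0 < 1 - x / βstar := by linarith
    positivity
  refine ⟨?_, ?_⟩
  · intro x hx y hy hxy
    change _ / _ < _ / _
    rw [hr x hx.2, hr y hy.2]
    exact key x y hx.1.le hxy hy.2
  · intro d hd0 hd
    rw [hr d hd]
    have h := key 0 d le_rfl hd0 hd
    simpa using h
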